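/- arXiv:2107.10816 — 7 statements merged into one kernel-verified Lean document; each statement's English description precedes it below -/
import Mathlib

section
/- The relation ≼ on K(X,Γ) is transitive: for all a, b, c ∈ K(X,Γ), if a ≼ b and b ≼ c then a ≼ c. -/
open Pointwise TopologicalSpace

/-- The dynamical subequivalence relation `a ≼ b` on tuples (lists) of open subsets of `X`:
for every choice of compact sets `F i ⊆ a.get i` there are, for each `i`, finitely many
open sets `U i j` covering `F i`, group elements `s i j` and indices `k i j` such that
`s i j • U i j ⊆ b.get (k i j)` and the translates landing in the same component are
pairwise disjoint. -/
def DynSubeq (Γ : Type*) [Group Γ] {X : Type*} [TopologicalSpace X] [MulAction Γ X]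
    (a b : List (Opens X)) : Prop :=
  ∀ F : Fin a.length → Set X,
    (∀ i, IsCompact (F i)) → (∀ i, F i ⊆ (a.get i : Set X)) →
    ∃ (J : Fin a.length → ℕ)
      (U : (i : Fin a.length) → Fin (J i) → Set X)
      (s : (i : Fin a.length) → Fin (J i) → Γ)
      (k : (i : Fin a.length) → Fin (J i) → Fin b.length),
      (∀ i j, IsOpen (U i j)) ∧
      (∀ i, F i ⊆ ⋃ j, U i j) ∧
      (∀ i j, s i j • U i j ⊆ (b.get (k i j) : Set X)) ∧
      (∀ (i : Fin a.length) (j : Fin (J i)) (i' : Fin a.length) (j' : Fin (J i')),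
        (i.val, j.val) ≠ (i'.val, j'.val) → k i j = k i' j' →
        Disjoint (s i j • U i j) (s i' j' • U i' j'))

/-- The way-below relation `a ≪ b` on tuples of open subsets of `X`: the tuples have the
same length and each entry of `a` has compact closure contained in the corresponding
entry of `b`. -/
def DynWB {X : Type*} [TopologicalSpace X] (a b : List (Opens X)) : Prop :=
  ∃ h : a.length = b.length, ∀ i : Fin a.length,
    IsCompact (closure ((a.get i) : Set X)) ∧
    closure ((a.get i) : Set X) ⊆ ((b.get (Fin.cast h i)) : Set X)

/-- The auxiliary relation `a ≺ b`: there is `c` with `a ≼ c ≪ b`. -/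
def DynAux (Γ : Type*) [Group Γ] {X : Type*} [TopologicalSpace X] [MulAction Γ X]
    (a b : List (Opens X)) : Prop :=
  ∃ c : List (Opens X), DynSubeq Γ a c ∧ DynWB c b

/-- A finite family of open sets, indexed over each `i` by an arbitrary finite type, may be
reindexed by `Fin` to give the data required by `DynSubeq`. -/
theorem exists_fin_indexed_of_finite {Γ X : Type*} [Group Γ] [TopologicalSpace X]
    [MulAction Γ X] {n m : ℕ} {F : Fin n → Set X} {V : Fin m → Set X}
    {ι : Fin n → Type*} [∀ i, Finite (ι i)]
    (U : ∀ i, ι i → Set X) (s : ∀ i, ι i → Γ) (k : ∀ i, ι i → Fin m)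
    (hopen : ∀ i j, IsOpen (U i j)) (hcover : ∀ i, F i ⊆ ⋃ j, U i j)
    (hsub : ∀ i j, s i j • U i j ⊆ V (k i j))
    (hdisj : ∀ x y : Σ i, ι i, x ≠ y → k x.1 x.2 = k y.1 y.2 →
      Disjoint (s x.1 x.2 • U x.1 x.2) (s y.1 y.2 • U y.1 y.2)) :
    ∃ (J : Fin n → ℕ) (U : (i : Fin n) → Fin (J i) → Set X)
      (s : (i : Fin n) → Fin (J i) → Γ) (k : (i : Fin n) → Fin (J i) → Fin m),
      (∀ i j, IsOpen (U i j)) ∧ (∀ i, F i ⊆ ⋃ j, U i j) ∧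
      (∀ i j, s i j • U i j ⊆ V (k i j)) ∧
      (∀ (i : Fin n) (j : Fin (J i)) (i' : Fin n) (j' : Fin (J i')),
        (i.val, j.val) ≠ (i'.val, j'.val) → k i j = k i' j' →
        Disjoint (s i j • U i j) (s i' j' • U i' j')) := by
  let e (i : Fin n) : Fin (Nat.card (ι i)) ≃ ι i := (Finite.equivFin (ι i)).symm
  refine ⟨fun i => Nat.card (ι i), fun i j => U i (e i j), fun i j => s i (e i j),
    fun i j => k i (e i j), fun i j => hopen i _, fun i => ?_, fun i j => hsub i _, ?_⟩
  · rw [(e i).surjective.iUnion_comp (U i)]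
    exact hcover i
  · intro i j i' j' hne hk
    refine hdisj ⟨i, e i j⟩ ⟨i', e i' j'⟩ (fun h => hne ?_) hk
    obtain ⟨rfl, h⟩ := Sigma.mk.inj_iff.mp h
    rw [(e i).injective (eq_of_heq h)]

/-- A compact set covered by finitely many open sets is covered by compact subsets of them. -/
theorem IsCompact.exists_isCompact_cover_of_finite {X ι : Type*} [TopologicalSpace X] [T2Space X]
    [Finite ι] {K : Set X} (hK : IsCompact K) {U : ι → Set X} (hU : ∀ i, IsOpen (U i))
    (hKU : K ⊆ ⋃ i, U i) :
    ∃ C : ι → Set X, (∀ i, IsCompact (C i)) ∧ (∀ i, C i ⊆ U i) ∧ K ⊆ ⋃ i, C i := by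
  have := Fintype.ofFinite ι
  obtain ⟨C, hC, hCU, hKC⟩ := hK.finite_compact_cover Finset.univ U (fun i _ => hU i)
    (by simpa using hKU)
  exact ⟨C, hC, hCU, by simp [hKC]⟩

/-- The relation `≼` on `K(X, Γ)` is transitive. -/
theorem dynSubeq_trans {X : Type*} [TopologicalSpace X] [LocallyCompactSpace X] [T2Space X]
    [SecondCountableTopology X] {Γ : Type*} [Group Γ] [Countable Γ] [Infinite Γ]
    [MulAction Γ X] [ContinuousConstSMul Γ X]
    (a b c : List (Opens X)) (hab : DynSubeq Γ a b) (hbc : DynSubeq Γ b c) :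
    DynSubeq Γ a c := by
  intro F hF hFa
  obtain ⟨J, U, s, k, hU, hFU, hUb, hUd⟩ := hab F hF hFa
  choose C hC hCU hFC using fun i => (hF i).exists_isCompact_cover_of_finite (hU i) (hFU i)
  let G (m : Fin b.length) : Set X :=
    ⋃ p : {p : Σ i, Fin (J i) // k p.1 p.2 = m}, s p.1.1 p.1.2 • C p.1.1 p.1.2
  obtain ⟨L, V, t, r, hV, hGV, hVc, hVd⟩ := hbc G
    (fun m => isCompact_iUnion fun p => (hC p.1.1 p.1.2).smul _)
    (by
      refine fun m => Set.iUnion_subset ?_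
      rintro ⟨⟨i, j⟩, rfl⟩
      exact (Set.smul_set_mono (hCU i j)).trans (hUb i j))
  have translate (i : Fin a.length) (q : Σ j : Fin (J i), Fin (L (k i j))) :
      (t (k i q.1) q.2 * s i q.1) • (U i q.1 ∩ (s i q.1)⁻¹ • V (k i q.1) q.2) =
        t (k i q.1) q.2 • (s i q.1 • U i q.1) ∩ t (k i q.1) q.2 • V (k i q.1) q.2 := by
    rw [mul_smul, Set.smul_set_inter, smul_inv_smul, Set.smul_set_inter]
  refine exists_fin_indexed_of_finite (V := fun m => (c.get m : Set X))
    (ι := fun i => Σ j : Fin (J i), Fin (L (k i j)))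
    (fun i q => U i q.1 ∩ (s i q.1)⁻¹ • V (k i q.1) q.2)
    (fun i q => t (k i q.1) q.2 * s i q.1) (fun i q => r (k i q.1) q.2)
    (fun i q => (hU i q.1).inter ((hV _ q.2).smul _)) ?_ ?_ ?_
  · intro i x hx
    obtain ⟨j, hj⟩ := Set.mem_iUnion.mp (hFC i hx)
    have hxG : s i j • x ∈ G (k i j) :=
      Set.mem_iUnion.mpr ⟨⟨⟨i, j⟩, rfl⟩, Set.smul_mem_smul_set hj⟩
    obtain ⟨l, hl⟩ := Set.mem_iUnion.mp (hGV _ hxG)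
    exact Set.mem_iUnion.mpr ⟨⟨j, l⟩, hCU i j hj, Set.mem_inv_smul_set_iff.mpr hl⟩
  · intro i q
    rw [translate]
    exact Set.inter_subset_right.trans (hVc _ _)
  · rintro ⟨i, j, l⟩ ⟨i', j', l'⟩ hne hr
    rw [translate i ⟨j, l⟩, translate i' ⟨j', l'⟩]
    by_cases h : ((k i j).val, l.val) = ((k i' j').val, l'.val)
    · obtain ⟨hk, hl⟩ := Prod.mk.inj h
      have hk := Fin.ext hk
      have ht : t (k i j) l = t (k i' j') l' := by
        congr 1
        exact (Fin.heq_ext_iff (congrArg L hk)).mpr hl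
      have hij : (i.val, j.val) ≠ (i'.val, j'.val) := by
        intro h
        obtain ⟨hi, hj⟩ := Prod.mk.inj h
        obtain rfl := Fin.ext hi
        obtain rfl := Fin.ext hj
        obtain rfl := Fin.ext hl
        exact hne rfl
      refine Disjoint.mono Set.inter_subset_left Set.inter_subset_left ?_
      rw [ht]
      exact Set.disjoint_smul_set.mpr (hUd i j i' j' hij hk)
    · exact (hVd _ l _ l' h hr).mono Set.inter_subset_right Set.inter_subset_right
end

section
/- For a ∈ O_n(X) and b ∈ O_m(X), the following are equivalent: (i) a ≼ b; (ii) for every c ∈ O_n(X) with c ≪ a there exists d ∈ O_m(X) with d ≪ b and c ≼ d. -/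
open Pointwise TopologicalSpace

/-- A finite open cover of a compact set in a locally compact Hausdorff space can be shrunk to an
open cover whose members have compact closure inside the original ones. -/
theorem IsCompact.exists_open_shrinking_of_finite {X ι : Type*} [TopologicalSpace X]
    [LocallyCompactSpace X] [T2Space X] [Fintype ι] {K : Set X} (hK : IsCompact K)
    {U : ι → Set X} (hU : ∀ j, IsOpen (U j)) (hKU : K ⊆ ⋃ j, U j) :
    ∃ V : ι → Set X, (∀ j, IsOpen (V j)) ∧ (∀ j, IsCompact (closure (V j))) ∧
      (∀ j, closure (V j) ⊆ U j) ∧ K ⊆ ⋃ j, V j := by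
  obtain ⟨L, hL, hLU, rfl⟩ := hK.finite_compact_cover Finset.univ U (fun j _ ↦ hU j)
    (by simpa using hKU)
  choose V hVo hLV hVU hVc using fun j ↦ exists_open_between_and_isCompact_closure
    (hL j) (hU j) (hLU j)
  refine ⟨V, hVo, hVc, hVU, ?_⟩
  simpa using Set.iUnion_mono hLV

/-- If `a ≼ b` and `c ≪ a`, then `c ≼ d` for some `d ≪ b`. -/
theorem DynSubeq.exists_wayBelow {X : Type*} [TopologicalSpace X] [LocallyCompactSpace X]
    [T2Space X] {Γ : Type*} [Group Γ] [MulAction Γ X] [ContinuousConstSMul Γ X]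
    {a b c : List (Opens X)} (hab : DynSubeq Γ a b) (hca : DynWB c a) :
    ∃ d : List (Opens X), DynWB d b ∧ DynSubeq Γ c d := by
  obtain ⟨h, hc⟩ := hca
  obtain ⟨J, U, s, k, hUo, hFU, hUb, hdisj⟩ := hab
    (fun i ↦ closure (c.get (Fin.cast h.symm i) : Set X)) (fun i ↦ (hc _).1) (fun i ↦ (hc _).2)
  choose V hVo hVc hVU hFV using fun i ↦
    (hc (Fin.cast h.symm i)).1.exists_open_shrinking_of_finite (hUo i) (hFU i)
  let e : Fin b.length → Opens X := fun l ↦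
    ⟨⋃ p : {p : Σ i, Fin (J i) // k p.1 p.2 = l}, s p.1.1 p.1.2 • V p.1.1 p.1.2,
      isOpen_iUnion fun p ↦ (hVo _ _).smul _⟩
  have he : ∀ l, closure (e l : Set X) = ⋃ p : {p : Σ i, Fin (J i) // k p.1 p.2 = l},
      s p.1.1 p.1.2 • closure (V p.1.1 p.1.2) := fun l ↦ by
    simp only [e, Opens.coe_mk, closure_iUnion_of_finite, closure_smul]
  refine ⟨List.ofFn e, ⟨List.length_ofFn, fun l ↦ ?_⟩, fun F _ hF ↦ ?_⟩
  · rw [List.get_ofFn, he]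
    refine ⟨isCompact_iUnion fun p ↦ (hVc _ _).smul _, Set.iUnion_subset ?_⟩
    rintro ⟨p, hp⟩
    simp only [← hp]
    exact (Set.smul_set_mono (hVU _ _)).trans (hUb _ _)
  · refine ⟨fun i ↦ J (Fin.cast h i), fun i ↦ V (Fin.cast h i), fun i ↦ s (Fin.cast h i),
      fun i j ↦ Fin.cast List.length_ofFn.symm (k (Fin.cast h i) j), fun i ↦ hVo _,
      fun i ↦ ((hF i).trans subset_closure).trans (hFV (Fin.cast h i)), fun i j ↦ ?_,
      fun i j i' j' hne hk ↦ ?_⟩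
    · rw [List.get_ofFn]
      exact Set.subset_iUnion_of_subset ⟨⟨Fin.cast h i, j⟩, rfl⟩ subset_rfl
    · exact (hdisj (Fin.cast h i) j (Fin.cast h i') j' hne (Fin.cast_injective _ hk)).mono
        (Set.smul_set_mono (subset_closure.trans (hVU _ _)))
        (Set.smul_set_mono (subset_closure.trans (hVU _ _)))

/-- Compact subsets of the entries of `a` lie in the entries of some `c ≪ a`. -/
theorem DynWB.exists_of_isCompact {X : Type*} [TopologicalSpace X] [LocallyCompactSpace X]
    [T2Space X] {a : List (Opens X)} {F : Fin a.length → Set X}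
    (hF : ∀ i, IsCompact (F i)) (hFa : ∀ i, F i ⊆ (a.get i : Set X)) :
    ∃ (c : List (Opens X)) (h : c.length = a.length), DynWB c a ∧
      ∀ i, F (Fin.cast h i) ⊆ (c.get i : Set X) := by
  choose V hVo hFV hVa hVc using fun i ↦ exists_open_between_and_isCompact_closure
    (hF i) (a.get i).isOpen (hFa i)
  refine ⟨List.ofFn fun i ↦ ⟨V i, hVo i⟩, List.length_ofFn, ⟨List.length_ofFn, fun i ↦ ?_⟩,
    fun i ↦ ?_⟩
  · rw [List.get_ofFn]
    exact ⟨hVc _, hVa _⟩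
  · rw [List.get_ofFn]
    exact hFV _

/-- `a ≼ b` iff for every `c ≪ a` there exists `d ≪ b` with `c ≼ d`. -/
theorem dynSubeq_iff_forall_wayBelow_exists {X : Type*} [TopologicalSpace X] [LocallyCompactSpace X] [T2Space X]
    [SecondCountableTopology X] {Γ : Type*} [Group Γ] [Countable Γ] [Infinite Γ]
    [MulAction Γ X] [ContinuousConstSMul Γ X]
    (a b : List (Opens X)) (ha : 0 < a.length) (hb : 0 < b.length) :
    DynSubeq Γ a b ↔
      ∀ c : List (Opens X), DynWB c a → ∃ d : List (Opens X), DynWB d b ∧ DynSubeq Γ c d := by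
  refine ⟨fun hab c hca ↦ hab.exists_wayBelow hca, fun H F hF hFa ↦ ?_⟩
  obtain ⟨c, h, hca, hFc⟩ := DynWB.exists_of_isCompact hF hFa
  obtain ⟨d, ⟨h', hd⟩, hcd⟩ := H c hca
  obtain ⟨J, U, s, k, hUo, hFU, hUd, hdisj⟩ := hcd (fun i ↦ F (Fin.cast h i)) (fun i ↦ hF _) hFc
  exact ⟨fun i ↦ J (Fin.cast h.symm i), fun i ↦ U (Fin.cast h.symm i),
    fun i ↦ s (Fin.cast h.symm i), fun i j ↦ Fin.cast h' (k (Fin.cast h.symm i) j),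
    fun i ↦ hUo _, fun i ↦ hFU (Fin.cast h.symm i),
    fun i j ↦ ((hUd _ _).trans subset_closure).trans (hd _).2,
    fun i j i' j' hne hk ↦ hdisj (Fin.cast h.symm i) j (Fin.cast h.symm i') j' hne
      (Fin.cast_injective _ hk)⟩
end

section
/- If S satisfies (W1) for ≪, then S satisfies (W2) for ≺: every a ∈ S is a supremum of a^≺ = {b ∈ S : b ≺ a} with respect to ≼, i.e. b ≺ a implies b ≼ a, and every c ∈ S such that b ≼ c for all b with b ≺ a satisfies a ≼ c. -/
/-- Given relations `le` and `wb` on `S`, the derived relation `a ≺ b`: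
there exists `c` with `le a c` and `wb c b`. -/
def AuxOf {S : Type*} (le wb : S → S → Prop) (a b : S) : Prop :=
  ∃ c : S, le a c ∧ wb c b

/-- `S` satisfies axiom (W1) for a relation `R`: for every `a` there is a sequence `(aₖ)`
with `aₖ R a` and `aₖ R aₖ₊₁`, such that every `b` with `b R a` satisfies `b R aₖ` for
some `k`. -/
def SatW1 {S : Type*} (R : S → S → Prop) : Prop :=
  ∀ a : S, ∃ f : ℕ → S, (∀ k : ℕ, R (f k) a) ∧ (∀ k : ℕ, R (f k) (f (k + 1))) ∧
    ∀ b : S, R b a → ∃ k : ℕ, R b (f k)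

/-- If `S` satisfies (W1) for `≪`, then `S` satisfies (W2) for `≺`: every `a` is a
supremum of `{b : b ≺ a}` with respect to `≼`. -/
theorem satW2_auxOf {S : Type*} [AddCommMonoid S] (le wb : S → S → Prop)
    (hle_refl : ∀ a : S, le a a)
    (hle_trans : ∀ a b c : S, le a b → le b c → le a c)
    (hle_add : ∀ a b c : S, le a b → le (a + c) (b + c))
    (hle_zero : ∀ a : S, le 0 a)
    (hwb_trans : ∀ a b c : S, wb a b → wb b c → wb a c)
    (hwb_zero : ∀ a : S, wb 0 a)
    (hwb_le : ∀ a b : S, wb a b → le a b)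
    (hmain : ∀ a b : S, le a b ↔ ∀ c : S, wb c a → AuxOf le wb c b)
    (hW1 : SatW1 wb) :
    ∀ a : S, (∀ b : S, AuxOf le wb b a → le b a) ∧
      ∀ c : S, (∀ b : S, AuxOf le wb b a → le b c) → le a c := by
  refine fun a => ⟨fun b ⟨d, hbd, hda⟩ => hle_trans b d a hbd (hwb_le d a hda), fun c hc => ?_⟩
  obtain ⟨f, hfa, -, hf⟩ := hW1 a
  refine (hmain a c).2 fun b hb => ?_
  obtain ⟨k, hk⟩ := hf b hb
  exact (hmain (f k) c).1 (hc (f k) ⟨f k, hle_refl _, hfa k⟩) b hk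
end

section
/- K(X,Γ) satisfies (W1) for the relation ≪: for every a ∈ O_n(X) there exists a sequence (a_k)_{k∈ℕ} in O_n(X) with a_k ≪ a and a_k ≪ a_{k+1} for all k, and such that every b ∈ O_n(X) with b ≪ a satisfies b ≪ a_k for some k. -/
open Pointwise TopologicalSpace

/-- Every open subset of a locally compact Hausdorff second countable space is exhausted by a
sequence of open sets, each relatively compact in the next. -/
theorem exists_openExhaustion {X : Type*} [TopologicalSpace X] [LocallyCompactSpace X]
    [T2Space X] [SecondCountableTopology X] (U : Opens X) :
    ∃ V : ℕ → Opens X, (∀ k, IsCompact (closure (V k : Set X))) ∧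
      (∀ k, closure (V k : Set X) ⊆ U) ∧
      (∀ k, closure (V k : Set X) ⊆ V (k + 1)) ∧
      Monotone V ∧ ∀ K : Set X, IsCompact K → K ⊆ U → ∃ k, K ⊆ V k := by
  have : LocallyCompactSpace U := U.isOpen.locallyCompactSpace
  let E : CompactExhaustion U := default
  have hE : ∀ k, IsCompact ((↑) '' E k : Set X) := fun k =>
    (E.isCompact k).image continuous_subtype_val
  let V : ℕ → Opens X := fun k =>
    ⟨(↑) '' interior (E k), U.isOpen.isOpenMap_subtype_val _ isOpen_interior⟩
  have hVE : ∀ k, closure (V k : Set X) ⊆ (↑) '' E k := fun k =>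
    closure_minimal (Set.image_mono interior_subset) (hE k).isClosed
  have hsucc : ∀ k, closure (V k : Set X) ⊆ V (k + 1) := fun k =>
    (hVE k).trans (Set.image_mono (E.subset_interior_succ k))
  refine ⟨V, fun k => (hE k).of_isClosed_subset isClosed_closure (hVE k), fun k => ?_, hsucc,
    monotone_nat_of_le_succ fun k => subset_closure.trans (hsucc k), fun K hK hKU => ?_⟩
  · exact (hVE k).trans (Subtype.coe_image_subset _ _)
  · have hK' : IsCompact ((↑) ⁻¹' K : Set U) :=
      U.isOpen.isOpenEmbedding_subtypeVal.isInducing.isCompact_preimage' hK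
        (by simpa using hKU)
    obtain ⟨k, hk⟩ := E.exists_superset_of_isCompact hK'
    refine ⟨k + 1, fun x hx => ⟨⟨x, hKU hx⟩, E.subset_interior_succ k (hk hx), rfl⟩⟩

/-- `K(X, Γ)` satisfies (W1) for the way-below relation `≪`. -/
theorem dynWB_satW1 {X : Type*} [TopologicalSpace X] [LocallyCompactSpace X] [T2Space X]
    [SecondCountableTopology X] {Γ : Type*} [Group Γ] [Countable Γ] [Infinite Γ]
    [MulAction Γ X] [ContinuousConstSMul Γ X]
    (a : List (Opens X)) (ha : 0 < a.length) :
    ∃ f : ℕ → List (Opens X), (∀ k : ℕ, DynWB (f k) a) ∧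
      (∀ k : ℕ, DynWB (f k) (f (k + 1))) ∧
      ∀ b : List (Opens X), DynWB b a → ∃ k : ℕ, DynWB b (f k) := by
  choose V hcomp hsub hsucc hmono hexh using exists_openExhaustion (X := X)
  refine ⟨fun k => a.map fun U => V U k, fun k => ⟨by simp, fun i => ?_⟩,
    fun k => ⟨by simp, fun i => ?_⟩, fun b ⟨h, hb⟩ => ?_⟩
  · simpa using ⟨hcomp _ k, hsub _ k⟩
  · simpa using ⟨hcomp _ k, hsucc _ k⟩
  · choose k hk using fun i => hexh _ _ (hb i).1 (hb i).2
    refine ⟨Finset.univ.sup k, by simpa using h, fun i => ⟨(hb i).1, ?_⟩⟩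
    have hle : k i ≤ Finset.univ.sup k := Finset.le_sup (Finset.mem_univ i)
    simpa using (hk i).trans (hmono _ hle)
end

section
/- K(X,Γ) satisfies (W4) for the relation ≪: if b ∈ O_n(X), c ∈ O_m(X) and a ∈ K(X,Γ) satisfy a ≪ b + c, then there exist b' ∈ O_n(X) and c' ∈ O_m(X) with b' ≪ b, c' ≪ c and a ≪ b' + c'. -/
open Pointwise TopologicalSpace

theorem dynWB_iff_forall₂ {X : Type*} [TopologicalSpace X] {a b : List (Opens X)} :
    DynWB a b ↔ List.Forall₂ (fun U V : Opens X =>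
      IsCompact (closure (U : Set X)) ∧ closure (U : Set X) ⊆ (V : Set X)) a b := by
  rw [List.forall₂_iff_get]
  constructor
  · rintro ⟨h, H⟩
    exact ⟨h, fun i hi _ => H ⟨i, hi⟩⟩
  · rintro ⟨h, H⟩
    exact ⟨h, fun i => H i i.2 (h ▸ i.2)⟩

/-- Interpolation for `≪` in a locally compact Hausdorff space. -/
theorem DynWB.exists_between {X : Type*} [TopologicalSpace X] [LocallyCompactSpace X] [T2Space X]
    {a b : List (Opens X)} (h : DynWB a b) : ∃ d, DynWB a d ∧ DynWB d b := by
  simp only [dynWB_iff_forall₂] at h ⊢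
  induction h with
  | nil => exact ⟨[], .nil, .nil⟩
  | @cons U V _ _ hUV _ ih =>
    obtain ⟨d, had, hdb⟩ := ih
    obtain ⟨W, hWo, hUW, hWV, hW⟩ :=
      exists_open_between_and_isCompact_closure hUV.1 V.isOpen hUV.2
    exact ⟨⟨W, hWo⟩ :: d, .cons ⟨hUV.1, hUW⟩ had, .cons ⟨hW, hWV⟩ hdb⟩

/-- `K(X, Γ)` satisfies (W4) for the way-below relation `≪`. -/
theorem dynWB_satW4 {X : Type*} [TopologicalSpace X] [LocallyCompactSpace X] [T2Space X]
    [SecondCountableTopology X] {Γ : Type*} [Group Γ] [Countable Γ] [Infinite Γ]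
    [MulAction Γ X] [ContinuousConstSMul Γ X]
    (a b c : List (Opens X)) (hb : 0 < b.length) (hc : 0 < c.length)
    (h : DynWB a (b ++ c)) :
    ∃ b' c' : List (Opens X), DynWB b' b ∧ DynWB c' c ∧ DynWB a (b' ++ c') := by
  obtain ⟨d, had, hd⟩ := h.exists_between
  rw [dynWB_iff_forall₂] at hd
  refine ⟨d.take b.length, d.drop b.length, ?_, ?_, by rwa [List.take_append_drop]⟩
  · simpa [dynWB_iff_forall₂] using List.forall₂_take b.length hd
  · simpa [dynWB_iff_forall₂] using List.forall₂_drop b.length hd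
end

section
/- The relation ≺ descends to the quotient by ≈: if a, a₁, b, b₁ ∈ K(X,Γ) satisfy a ≺ b, a₁ ≈ a and b₁ ≈ b (where a ≈ b means a ≼ b and b ≼ a), then a₁ ≺ b₁. -/
open Pointwise TopologicalSpace

section

variable {X : Type*} [TopologicalSpace X] {Γ : Type*} [Group Γ] [MulAction Γ X]

/-- Dynamical subequivalence with the open covers of all the components indexed by a single
finite type `ι`, the map `q` recording the component to which each open set belongs. -/
theorem dynSubeq_iff_exists_finite {a b : List (Opens X)} :
    DynSubeq Γ a b ↔ ∀ F : Fin a.length → Set X,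
      (∀ i, IsCompact (F i)) → (∀ i, F i ⊆ (a.get i : Set X)) →
      ∃ (ι : Type) (_ : Finite ι) (q : ι → Fin a.length) (U : ι → Set X) (s : ι → Γ)
        (k : ι → Fin b.length),
        (∀ x, IsOpen (U x)) ∧
        (∀ i, F i ⊆ ⋃ (x) (_ : q x = i), U x) ∧
        (∀ x, s x • U x ⊆ (b.get (k x) : Set X)) ∧
        (∀ x y, x ≠ y → k x = k y → Disjoint (s x • U x) (s y • U y)) := by
  refine forall_congr' fun F => forall_congr' fun _ => forall_congr' fun _ => ⟨?_, ?_⟩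
  · rintro ⟨J, U, s, k, hU, hF, hs, hd⟩
    refine ⟨Σ i, Fin (J i), inferInstance, Sigma.fst, fun x => U x.1 x.2, fun x => s x.1 x.2,
      fun x => k x.1 x.2, fun x => hU _ _, fun i y hy => ?_, fun x => hs _ _, ?_⟩
    · obtain ⟨j, hj⟩ := Set.mem_iUnion.1 (hF i hy)
      exact Set.mem_iUnion₂.2 ⟨⟨i, j⟩, rfl, hj⟩
    · rintro ⟨i, j⟩ ⟨i', j'⟩ hne hk
      refine hd i j i' j' (fun h => hne ?_) hk
      obtain ⟨h₁, h₂⟩ := Prod.mk.inj h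
      obtain rfl := Fin.ext h₁
      obtain rfl := Fin.ext h₂
      rfl
  · rintro ⟨ι, _, q, U, s, k, hU, hF, hs, hd⟩
    let e (i : Fin a.length) : Fin (Nat.card {x // q x = i}) ≃ {x // q x = i} :=
      (Finite.equivFin _).symm
    refine ⟨fun i => Nat.card {x // q x = i}, fun i j => U (e i j), fun i j => s (e i j),
      fun i j => k (e i j), fun i j => hU _, fun i y hy => ?_, fun i j => hs _, ?_⟩
    · obtain ⟨x, hx, hy⟩ := Set.mem_iUnion₂.1 (hF i hy)
      exact Set.mem_iUnion.2 ⟨(e i).symm ⟨x, hx⟩, by simpa using hy⟩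
    · intro i j i' j' hne hk
      refine hd _ _ (fun h => hne ?_) hk
      have hi : i = i' := by rw [← (e i j).2, h, (e i' j').2]
      subst hi
      rw [(e i).injective (Subtype.ext h)]

/-- Finite open covers of a family of compact sets shrink to covers by compact sets. -/
theorem exists_compact_shrinking_of_fibers [R1Space X] {ι κ : Type*} [Finite ι]
    (q : ι → κ) {F : κ → Set X} (hF : ∀ i, IsCompact (F i)) {U : ι → Set X}
    (hU : ∀ x, IsOpen (U x)) (hFU : ∀ i, F i ⊆ ⋃ (x) (_ : q x = i), U x) :
    ∃ K : ι → Set X, (∀ x, IsCompact (K x)) ∧ (∀ x, K x ⊆ U x) ∧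
      ∀ i, F i ⊆ ⋃ (x) (_ : q x = i), K x := by
  classical
  have := Fintype.ofFinite ι
  have h (i) := (hF i).finite_compact_cover (Finset.univ.filter fun x => q x = i) U
    (fun x _ => hU x) (by simpa using hFU i)
  choose K hK hKU hFK using h
  refine ⟨fun x => K (q x) x, fun x => hK _ _, fun x => hKU _ _, fun i y hy => ?_⟩
  rw [hFK i] at hy
  obtain ⟨x, hx, hy⟩ := Set.mem_iUnion₂.1 hy
  obtain rfl : q x = i := by simpa using hx
  exact Set.mem_iUnion₂.2 ⟨x, rfl, hy⟩

variable [ContinuousConstSMul Γ X]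

theorem DynSubeq.trans [R1Space X] {a b c : List (Opens X)} (hab : DynSubeq Γ a b)
    (hbc : DynSubeq Γ b c) : DynSubeq Γ a c := by
  rw [dynSubeq_iff_exists_finite] at *
  intro F hF hFa
  obtain ⟨ι, _, q, U, s, k, hU, hFU, hs, hd⟩ := hab F hF hFa
  obtain ⟨K, hK, hKU, hFK⟩ := exists_compact_shrinking_of_fibers q hF hU hFU
  obtain ⟨κ, _, r, W, t, p, hW, hGW, ht, he⟩ := hbc (fun l => ⋃ (x) (_ : k x = l), s x • K x)
    (fun l => isCompact_iUnion fun x => isCompact_iUnion fun _ => (hK x).smul (s x))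
    (fun l => Set.iUnion₂_subset fun x hx =>
      (Set.smul_set_mono (hKU x)).trans (hx ▸ hs x))
  refine ⟨{z : ι × κ // r z.2 = k z.1}, inferInstance, fun z => q z.1.1,
    fun z => U z.1.1 ∩ (s z.1.1)⁻¹ • W z.1.2, fun z => t z.1.2 * s z.1.1, fun z => p z.1.2,
    fun z => (hU _).inter ((hW _).smul _), fun i y hy => ?_, fun z => ?_, ?_⟩
  · obtain ⟨x, hx, hy⟩ := Set.mem_iUnion₂.1 (hFK i hy)
    obtain ⟨w, hw, hyw⟩ := Set.mem_iUnion₂.1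
      (hGW (k x) (Set.mem_iUnion₂.2 ⟨x, rfl, Set.smul_mem_smul_set hy⟩))
    exact Set.mem_iUnion₂.2 ⟨⟨(x, w), hw⟩, hx, hKU x hy, Set.mem_inv_smul_set_iff.2 hyw⟩
  · refine Set.Subset.trans ?_ (ht z.1.2)
    rw [mul_smul, Set.smul_set_inter, smul_inv_smul]
    exact Set.smul_set_mono Set.inter_subset_right
  · rintro ⟨⟨x, w⟩, hz⟩ ⟨⟨x', w'⟩, hz'⟩ hne hp
    simp only [mul_smul, Set.smul_set_inter, smul_inv_smul] at *
    by_cases hw : w = w'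
    · subst hw
      have hx : x ≠ x' := by rintro rfl; exact hne rfl
      exact ((Set.disjoint_smul_set.2 (hd x x' hx (hz.symm.trans hz'))).mono
        Set.inter_subset_left Set.inter_subset_left)
    · exact (he w w' hw hp).mono Set.inter_subset_right Set.inter_subset_right

/-- The relation `≪` followed by `≼` implies `≺`. -/
theorem DynWB.dynAux_of_dynSubeq [LocallyCompactSpace X] [R1Space X] {c b b' : List (Opens X)}
    (hcb : DynWB c b) (hb : DynSubeq Γ b b') : DynAux Γ c b' := by
  obtain ⟨hlen, hcb⟩ := hcb
  rw [dynSubeq_iff_exists_finite] at hb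
  have hF (i : Fin b.length) : IsCompact (closure (c.get (i.cast hlen.symm) : Set X)) :=
    (hcb _).1
  obtain ⟨ι, _, q, U, s, k, hU, hFU, hs, hd⟩ := hb _ hF fun i => (hcb (i.cast hlen.symm)).2
  obtain ⟨K, hK, hKU, hFK⟩ := exists_compact_shrinking_of_fibers q hF hU hFU
  choose V hV hKV hVU hVc using fun x =>
    exists_open_between_and_isCompact_closure (hK x) (hU x) (hKU x)
  let f (l : Fin b'.length) : Opens X :=
    ⟨⋃ (x) (_ : k x = l), s x • V x, isOpen_iUnion fun x => isOpen_iUnion fun _ => (hV x).smul _⟩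
  have hlen' : (List.ofFn f).length = b'.length := List.length_ofFn
  refine ⟨List.ofFn f, ?_, hlen', fun l => ?_⟩
  · rw [dynSubeq_iff_exists_finite]
    intro F _ hFc
    refine ⟨ι, inferInstance, fun x => (q x).cast hlen.symm, V, s, fun x => (k x).cast hlen'.symm,
      hV, fun i y hy => ?_, fun x => ?_, fun x y hxy hk => ?_⟩
    · obtain ⟨x, hx, hy⟩ := Set.mem_iUnion₂.1 (hFK (i.cast hlen) (subset_closure (hFc i hy)))
      exact Set.mem_iUnion₂.2 ⟨x, by simp [hx], hKV x hy⟩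
    · rw [List.get_ofFn]
      exact Set.subset_iUnion₂_of_subset x rfl subset_rfl
    · have hVU' (x) : V x ⊆ U x := subset_closure.trans (hVU x)
      exact (hd x y hxy (Fin.cast_injective _ hk)).mono (Set.smul_set_mono (hVU' x))
        (Set.smul_set_mono (hVU' y))
  · have hcl : closure ((List.ofFn f).get l : Set X) =
        ⋃ (x) (_ : k x = l.cast hlen'), s x • closure (V x) := by
      rw [List.get_ofFn]
      change closure (⋃ (x) (_ : k x = l.cast hlen'), s x • V x) = _
      simp only [closure_iUnion_of_finite, closure_smul]
    rw [hcl]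
    exact ⟨isCompact_iUnion fun x => isCompact_iUnion fun _ => (hVc x).smul (s x),
      Set.iUnion₂_subset fun x hx => (Set.smul_set_mono (hVU x)).trans (hx ▸ hs x)⟩

end

/-- The relation `≺` descends to the quotient by `≈`. -/
theorem dynAux_congr {X : Type*} [TopologicalSpace X] [LocallyCompactSpace X] [T2Space X]
    [SecondCountableTopology X] {Γ : Type*} [Group Γ] [Countable Γ] [Infinite Γ]
    [MulAction Γ X] [ContinuousConstSMul Γ X]
    (a a₁ b b₁ : List (Opens X)) (hab : DynAux Γ a b)
    (ha : DynSubeq Γ a₁ a ∧ DynSubeq Γ a a₁) (hb : DynSubeq Γ b₁ b ∧ DynSubeq Γ b b₁) :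
    DynAux Γ a₁ b₁ := by
  obtain ⟨c, hac, hcb⟩ := hab
  obtain ⟨d, hcd, hdb⟩ := hcb.dynAux_of_dynSubeq hb.2
  exact ⟨d, (ha.1.trans hac).trans hcd, hdb⟩
end

section
/- If in addition X is zero-dimensional (its topology has a basis consisting of compact open sets), then W(X,Γ) satisfies axiom (W5): for all a', a, b', b, c, c̃ ∈ K(X,Γ) with a + b ≺ c, a' ≺ a, b' ≺ b and c ≺ c̃, there exist x, x' ∈ K(X,Γ) such that a' + x ≺ c̃, c ≺ a + x', and b' ≺ x' ≺ x. -/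
open Pointwise TopologicalSpace

section DynW

variable {Γ : Type*} [Group Γ] {X : Type*} [TopologicalSpace X] [MulAction Γ X]

/-- The family of sets `F` is covered by finitely many open sets which can be translated into
the family `b` so that the translates landing in the same member of `b` are disjoint. -/
def DynCover (Γ : Type*) [Group Γ] {X : Type*} [TopologicalSpace X] [MulAction Γ X]
    {ι κ : Type} (F : ι → Set X) (b : κ → Set X) : Prop :=
  ∃ (T : Type) (_ : Finite T) (src : T → ι) (tgt : T → κ) (U : T → Set X) (s : T → Γ),
    (∀ t, IsOpen (U t)) ∧
    (∀ i, ∀ x ∈ F i, ∃ t, src t = i ∧ x ∈ U t) ∧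
    (∀ t, s t • U t ⊆ b (tgt t)) ∧
    (∀ t t', t ≠ t' → tgt t = tgt t' → Disjoint (s t • U t) (s t' • U t'))

/-- Covers are stable under bijective reindexing, shrinking the source and enlarging the
target. -/
lemma DynCover.mono {ι κ ι' κ' : Type} {F : ι → Set X} {b : κ → Set X} {F' : ι' → Set X}
    {b' : κ' → Set X} (h : DynCover Γ F b) (e : ι' ≃ ι) (e' : κ ≃ κ')
    (hF : ∀ i, F' i ⊆ F (e i)) (hb : ∀ k, b k ⊆ b' (e' k)) : DynCover Γ F' b' := by
  obtain ⟨T, hT, src, tgt, U, s, hU, hc, hs, hd⟩ := h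
  refine ⟨T, hT, e.symm ∘ src, e' ∘ tgt, U, s, hU, fun i x hx => ?_,
    fun t => (hs t).trans (hb _), fun t t' h h' => hd t t' h (e'.injective h')⟩
  obtain ⟨t, ht, hxt⟩ := hc _ x (hF i hx)
  exact ⟨t, by simp [ht], hxt⟩

lemma DynCover.refl {ι : Type} [Finite ι] {F : ι → Set X} (hF : ∀ i, IsOpen (F i)) :
    DynCover Γ F F :=
  ⟨ι, inferInstance, id, id, F, fun _ => 1, hF, fun i _ hx => ⟨i, rfl, hx⟩, by simp,
    fun _ _ h h' => (h h').elim⟩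

lemma DynCover.trans [ContinuousConstSMul Γ X] {ι κ μ : Type} {F : ι → Set X} {b : κ → Set X}
    {c : μ → Set X} (h : DynCover Γ F b) (h' : DynCover Γ b c) : DynCover Γ F c := by
  obtain ⟨T, hT, src, tgt, U, s, hU, hc, hs, hd⟩ := h
  obtain ⟨T', hT', src', tgt', U', s', hU', hc', hs', hd'⟩ := h'
  have key : ∀ t t', (s' t' * s t) • (U t ∩ (s t)⁻¹ • U' t') = s' t' • (s t • U t ∩ U' t') := by
    intro t t'
    rw [mul_smul, Set.smul_set_inter, smul_inv_smul]
  refine ⟨{p : T × T' // tgt p.1 = src' p.2}, inferInstance, fun p => src p.1.1,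
    fun p => tgt' p.1.2, fun p => U p.1.1 ∩ (s p.1.1)⁻¹ • U' p.1.2,
    fun p => s' p.1.2 * s p.1.1, fun p => (hU _).inter ((hU' _).smul _), ?_, ?_, ?_⟩
  · intro i x hx
    obtain ⟨t, rfl, hxt⟩ := hc i x hx
    obtain ⟨t', ht', hxt'⟩ := hc' _ _ (hs t (Set.smul_mem_smul_set hxt))
    exact ⟨⟨(t, t'), ht'.symm⟩, rfl, hxt, Set.mem_inv_smul_set_iff.2 hxt'⟩
  · intro p
    rw [key]
    exact (Set.smul_set_mono Set.inter_subset_right).trans (hs' _)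
  · rintro ⟨⟨t, t'⟩, h1⟩ ⟨⟨r, r'⟩, h2⟩ hne htgt
    simp only [key]
    by_cases hr : t' = r'
    · subst hr
      have htr : t ≠ r := by rintro rfl; exact hne rfl
      exact (Set.disjoint_smul_set.2 ((hd t r htr (h1.trans h2.symm)).mono
        Set.inter_subset_left Set.inter_subset_left))
    · exact (hd' t' r' hr htgt).mono (Set.smul_set_mono Set.inter_subset_right)
        (Set.smul_set_mono Set.inter_subset_right)

lemma DynCover.sum {ι κ ι' κ' : Type} {F : ι → Set X} {b : κ → Set X} {F' : ι' → Set X}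
    {b' : κ' → Set X} (h : DynCover Γ F b) (h' : DynCover Γ F' b') :
    DynCover Γ (Sum.elim F F') (Sum.elim b b') := by
  obtain ⟨T, hT, src, tgt, U, s, hU, hc, hs, hd⟩ := h
  obtain ⟨T', hT', src', tgt', U', s', hU', hc', hs', hd'⟩ := h'
  refine ⟨T ⊕ T', inferInstance, Sum.map src src', Sum.map tgt tgt', Sum.elim U U',
    Sum.elim s s', ?_, ?_, ?_, ?_⟩
  · rintro (t | t)
    exacts [hU t, hU' t]
  · rintro (i | i) x hx
    · obtain ⟨t, rfl, hxt⟩ := hc i x hx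
      exact ⟨.inl t, rfl, hxt⟩
    · obtain ⟨t, rfl, hxt⟩ := hc' i x hx
      exact ⟨.inr t, rfl, hxt⟩
  · rintro (t | t)
    exacts [hs t, hs' t]
  · rintro (t | t) (r | r) hne htgt
    · exact hd t r (fun h => hne (congrArg _ h)) (Sum.inl_injective htgt)
    · cases htgt
    · cases htgt
    · exact hd' t r (fun h => hne (congrArg _ h)) (Sum.inr_injective htgt)

lemma dynSubeq_iff_dynCover {a b : List (Opens X)} :
    DynSubeq Γ a b ↔ ∀ F : Fin a.length → Set X, (∀ i, IsCompact (F i)) →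
      (∀ i, F i ⊆ (a.get i : Set X)) → DynCover Γ F fun k => (b.get k : Set X) := by
  refine forall_congr' fun F => forall_congr' fun _ => forall_congr' fun _ => ?_
  constructor
  · rintro ⟨J, U, s, k, hU, hc, hs, hd⟩
    refine ⟨Σ i, Fin (J i), inferInstance, Sigma.fst, fun t => k t.1 t.2, fun t => U t.1 t.2,
      fun t => s t.1 t.2, fun t => hU _ _, fun i x hx => ?_, fun t => hs _ _, ?_⟩
    · obtain ⟨j, hj⟩ := Set.mem_iUnion.1 (hc i hx)
      exact ⟨⟨i, j⟩, rfl, hj⟩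
    · rintro ⟨i, j⟩ ⟨i', j'⟩ hne
      refine hd i j i' j' fun h => hne ?_
      simp only [Prod.mk.injEq] at h
      obtain rfl := Fin.ext h.1
      rw [Fin.ext h.2]
  · rintro ⟨T, hT, src, tgt, U, s, hU, hc, hs, hd⟩
    let e i := (Finite.equivFin {t // src t = i}).symm
    refine ⟨fun i => Nat.card {t // src t = i}, fun i j => U (e i j), fun i j => s (e i j),
      fun i j => tgt (e i j), fun _ _ => hU _, fun i x hx => ?_, fun _ _ => hs _, ?_⟩
    · obtain ⟨t, ht, hxt⟩ := hc i x hx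
      exact Set.mem_iUnion.2 ⟨(e i).symm ⟨t, ht⟩, by simpa using hxt⟩
    · intro i j i' j' hne
      refine hd _ _ fun h => hne ?_
      obtain rfl : i = i' := by rw [← (e i j).2, ← (e i' j').2, h]
      rw [(e i).injective (Subtype.ext h)]

lemma DynCover.dynSubeq_ofFn {a : List (Opens X)} {n : ℕ} {B : Fin n → Opens X}
    (h : ∀ F : Fin a.length → Set X, (∀ i, IsCompact (F i)) →
      (∀ i, F i ⊆ (a.get i : Set X)) → DynCover Γ F fun k => (B k : Set X)) :
    DynSubeq Γ a (List.ofFn B) :=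
  dynSubeq_iff_dynCover.2 fun F hF hFa => (h F hF hFa).mono (Equiv.refl _)
    (finCongr (by simp)) (fun _ => subset_rfl) (fun k => by simp [finCongr])

/-- The positions of a concatenation. -/
def appendIndexEquiv {α : Type*} (l m : List α) :
    Fin (l ++ m).length ≃ Fin l.length ⊕ Fin m.length :=
  (finCongr List.length_append).trans finSumFinEquiv.symm

lemma get_append_symm {α : Type*} (l m : List α) (i : Fin l.length ⊕ Fin m.length) :
    (l ++ m).get ((appendIndexEquiv l m).symm i) = Sum.elim l.get m.get i := by
  rcases i with i | i <;> simp [appendIndexEquiv]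

lemma exists_compactOpen_between
    (hzero : ∀ (p : X) (U : Set X), IsOpen U → p ∈ U →
      ∃ V : Set X, IsCompact V ∧ IsOpen V ∧ p ∈ V ∧ V ⊆ U)
    {K U : Set X} (hK : IsCompact K) (hU : IsOpen U) (hKU : K ⊆ U) :
    ∃ V : Opens X, IsCompact (V : Set X) ∧ K ⊆ V ∧ (V : Set X) ⊆ U := by
  refine hK.induction_on (p := fun K => ∃ V : Opens X, IsCompact (V : Set X) ∧ K ⊆ V ∧
    (V : Set X) ⊆ U) ⟨⊥, by simp⟩ ?_ ?_ ?_
  · rintro s t hst ⟨V, h, h', h''⟩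
    exact ⟨V, h, hst.trans h', h''⟩
  · rintro s t ⟨V, h, h', h''⟩ ⟨W, k, k', k''⟩
    exact ⟨V ⊔ W, by simpa using h.union k, by simpa using Set.union_subset_union h' k',
      by simp [h'', k'']⟩
  · intro x hx
    obtain ⟨V, hV, hVo, hxV, hVU⟩ := hzero x U hU (hKU hx)
    exact ⟨V, mem_nhdsWithin_of_mem_nhds (hVo.mem_nhds hxV), ⟨V, hVo⟩, hV, subset_rfl, hVU⟩

/-- A compact open set covered by finitely many open sets is partitioned into compact open
sets subordinate to the cover. -/
lemma exists_compactOpen_partition [T2Space X]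
    (hzero : ∀ (p : X) (U : Set X), IsOpen U → p ∈ U →
      ∃ V : Set X, IsCompact V ∧ IsOpen V ∧ p ∈ V ∧ V ⊆ U)
    {T : Type*} {U : T → Set X} (hU : ∀ t, IsOpen (U t)) (S : Finset T) (A : Set X)
    (hA : IsCompact A) (hAo : IsOpen A) (hAU : A ⊆ ⋃ t ∈ S, U t) :
    ∃ W : T → Set X, (∀ t, IsCompact (W t)) ∧ (∀ t, IsOpen (W t)) ∧ (∀ t, W t ⊆ U t) ∧
      Pairwise (fun t t' => Disjoint (W t) (W t')) ∧ ⋃ t, W t = A := by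
  classical
  induction S using Finset.induction_on generalizing A with
  | empty =>
    obtain rfl : A = ∅ := by simpa using hAU
    exact ⟨fun _ => ∅, by simp [Pairwise]⟩
  | insert t₀ S ht₀ ih =>
    obtain ⟨K, hK, h1, h2⟩ := exists_compactOpen_between hzero
      (hA.diff (isOpen_biUnion fun t (_ : t ∈ S) => hU t)) ((hU t₀).inter hAo) (by
        rintro x ⟨hx, hx'⟩
        have := hAU hx
        simp only [Finset.mem_insert, Set.iUnion_iUnion_eq_or_left] at this
        exact ⟨this.resolve_right hx', hx⟩)
    obtain ⟨W, hW, hWo, hWU, hWd, hWA⟩ := ih (A \ K) (hA.diff K.isOpen)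
      (hAo.sdiff hK.isClosed) (by
        rintro x ⟨hx, hx'⟩
        by_contra h
        exact hx' (h1 ⟨hx, h⟩))
    have hWK : ∀ t, Disjoint (W t) K := fun t =>
      (Set.disjoint_sdiff_left (s := (K : Set X)) (t := A)).mono_left
        ((Set.subset_iUnion W t).trans hWA.subset)
    have hKA : (K : Set X) ⊆ A := fun x hx => (h2 hx).2
    refine ⟨fun t => if t = t₀ then W t ∪ K else W t, fun t => ?_, fun t => ?_, fun t => ?_,
      fun t t' hne => ?_, ?_⟩
    · dsimp only; split_ifs
      exacts [(hW t).union hK, hW t]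
    · dsimp only; split_ifs
      exacts [(hWo t).union K.isOpen, hWo t]
    · dsimp only; split_ifs with h
      · subst h
        exact Set.union_subset (hWU t) fun x hx => (h2 hx).1
      · exact hWU t
    · have := hWd hne
      dsimp only; split_ifs with h h'
      · exact (hne (h.trans h'.symm)).elim
      · exact Set.disjoint_union_left.2 ⟨this, (hWK t').symm⟩
      · exact Set.disjoint_union_right.2 ⟨this, hWK t⟩
      · exact this
    · have : ⋃ t, (if t = t₀ then W t ∪ K else W t) = (⋃ t, W t) ∪ K := by
        ext x
        simp only [Set.mem_iUnion, Set.mem_union]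
        constructor
        · rintro ⟨t, ht⟩
          split_ifs at ht
          · exact ht.imp_left fun h => ⟨t, h⟩
          · exact .inl ⟨t, ht⟩
        · rintro (⟨t, ht⟩ | h)
          · refine ⟨t, ?_⟩
            split_ifs
            exacts [.inl ht, ht]
          · exact ⟨t₀, by simp [h]⟩
      rw [this, hWA, Set.sdiff_union_of_subset hKA]

/-- Complements of subequivalences between tuples of compact open sets. -/
lemma DynCover.exists_complement [T2Space X] [ContinuousConstSMul Γ X]
    (hzero : ∀ (p : X) (U : Set X), IsOpen U → p ∈ U →
      ∃ V : Set X, IsCompact V ∧ IsOpen V ∧ p ∈ V ∧ V ⊆ U)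
    {ι κ μ : Type} [Finite ι] [Finite μ] {A : ι → Set X} {B : κ → Set X} {G : μ → Set X}
    (hA : ∀ i, IsCompact (A i)) (hAo : ∀ i, IsOpen (A i))
    (hG : ∀ i, IsCompact (G i)) (hGo : ∀ i, IsOpen (G i))
    (h : DynCover Γ (Sum.elim A B) G) :
    ∃ R : μ → Opens X, (∀ i, IsCompact (R i : Set X)) ∧
      DynCover Γ (Sum.elim A fun i => (R i : Set X)) G ∧
      DynCover Γ G (Sum.elim A fun i => (R i : Set X)) ∧
      DynCover Γ B fun i => (R i : Set X) := by
  obtain ⟨T, hT, src, tgt, U, s, hU, hc, hs, hd⟩ := h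
  have : ∀ i, ∃ W : {t // src t = .inl i} → Set X, (∀ t, IsCompact (W t)) ∧
      (∀ t, IsOpen (W t)) ∧ (∀ t, W t ⊆ U t) ∧
      Pairwise (fun t t' => Disjoint (W t) (W t')) ∧ ⋃ t, W t = A i := by
    intro i
    have := Fintype.ofFinite {t // src t = Sum.inl i}
    refine exists_compactOpen_partition hzero
      (U := fun t : {t // src t = Sum.inl i} => U t) (fun t => hU t) Finset.univ (A i) (hA i)
      (hAo i) fun x hx => ?_
    obtain ⟨t, ht, hxt⟩ := hc (.inl i) x hx
    exact Set.mem_biUnion (x := ⟨t, ht⟩) (Finset.mem_coe.2 (Finset.mem_univ _)) hxt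
  choose W hW hWo hWU hWd hWA using this
  let P := Σ i, {t // src t = .inl i}
  let Y : P → Set X := fun p => s p.2 • W p.1 p.2
  have hYs : ∀ p : P, Y p ⊆ s p.2 • U p.2 := fun p => Set.smul_set_mono (hWU _ _)
  have hYG : ∀ p : P, Y p ⊆ G (tgt p.2) := fun p => (hYs p).trans (hs _)
  have hPinj : ∀ p p' : P, (p.2 : T) = p'.2 → p = p' := by
    rintro ⟨i, t, ht⟩ ⟨i', t', ht'⟩ (rfl : t = t')
    obtain rfl := Sum.inl_injective (ht.symm.trans ht')
    rfl
  have hYd : ∀ p p' : P, p ≠ p' → tgt p.2 = tgt p'.2 → Disjoint (Y p) (Y p') :=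
    fun p p' hne htgt => (hd _ _ (fun h => hne (hPinj _ _ h)) htgt).mono (hYs p) (hYs p')
  have hYo : ∀ p, IsOpen (Y p) := fun p => (hWo _ _).smul _
  have hYc : ∀ p, IsClosed (Y p) := fun p => ((hW _ _).smul _).isClosed
  let Z : μ → Set X := fun k => ⋃ p : {p : P // tgt p.2 = k}, Y p
  have hYZ : ∀ p : P, Y p ⊆ Z (tgt p.2) := fun p =>
    Set.subset_iUnion (fun q : {q : P // tgt q.2 = tgt p.2} => Y q) ⟨p, rfl⟩
  let R : μ → Opens X := fun k => ⟨G k \ Z k, (hGo k).sdiff (isClosed_iUnion_of_finite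
    fun p => hYc p)⟩
  have hWA' : ∀ p : P, W p.1 p.2 ⊆ A p.1 := fun p =>
    (Set.subset_iUnion (W p.1) p.2).trans (hWA p.1).subset
  refine ⟨R, fun k => (hG k).diff (isOpen_iUnion fun p => hYo p), ?_, ?_, ?_⟩
  · refine ⟨P ⊕ μ, inferInstance, Sum.map Sigma.fst id, Sum.elim (fun p => tgt p.2) id,
      Sum.elim (fun p => W p.1 p.2) (fun k => R k), Sum.elim (fun p => s p.2) fun _ => 1,
      ?_, ?_, ?_, ?_⟩
    · rintro (p | k)
      exacts [hWo _ _, (R k).isOpen]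
    · rintro (i | k) x hx
      · obtain ⟨t, ht⟩ := Set.mem_iUnion.1 ((hWA i).superset hx)
        exact ⟨.inl ⟨i, t⟩, rfl, ht⟩
      · exact ⟨.inr k, rfl, hx⟩
    · rintro (p | k)
      · exact hYG p
      · change (1 : Γ) • (G k \ Z k) ⊆ G k
        rw [one_smul]
        exact Set.sdiff_subset
    · have hYR : ∀ (p : P), Disjoint (Y p) (R (tgt p.2)) := fun p =>
        Set.disjoint_sdiff_right.mono_left (hYZ p)
      rintro (p | k) (p' | k') hne htgt
      · exact hYd p p' (fun h => hne (congrArg _ h)) htgt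
      · obtain rfl : tgt p.2 = k' := htgt
        simpa using hYR p
      · obtain rfl : k = tgt p'.2 := htgt
        simpa using (hYR p').symm
      · exact (hne (congrArg _ htgt)).elim
  · refine ⟨P ⊕ μ, inferInstance, Sum.elim (fun p => tgt p.2) id, Sum.map Sigma.fst id,
      Sum.elim Y (fun k => R k), Sum.elim (fun p => (s p.2)⁻¹) fun _ => 1, ?_, ?_, ?_, ?_⟩
    · rintro (p | k)
      exacts [hYo _, (R k).isOpen]
    · intro k x hx
      by_cases hxZ : x ∈ Z k
      · obtain ⟨⟨p, rfl⟩, hp⟩ := Set.mem_iUnion.1 hxZ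
        exact ⟨.inl p, rfl, hp⟩
      · exact ⟨.inr k, rfl, hx, hxZ⟩
    · rintro (p | k)
      · simpa [Y] using hWA' p
      · simp
    · rintro (⟨i, t⟩ | k) (⟨i', t'⟩ | k') hne htgt
      · obtain rfl : i = i' := Sum.inl_injective htgt
        have : t ≠ t' := by rintro rfl; exact hne rfl
        simpa [Y] using hWd i this
      · cases htgt
      · cases htgt
      · exact (hne (congrArg _ (Sum.inr_injective htgt))).elim
  · refine ⟨Σ k, {t // src t = .inr k}, ?_, Sigma.fst, fun p => tgt p.2, fun p => U p.2,
      fun p => s p.2, fun p => hU _, ?_, ?_, ?_⟩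
    · refine Finite.of_injective (fun p => (p.2 : T)) ?_
      rintro ⟨i, t, ht⟩ ⟨i', t', ht'⟩ (rfl : t = t')
      obtain rfl := Sum.inr_injective (ht.symm.trans ht')
      rfl
    · intro k x hx
      obtain ⟨t, ht, hxt⟩ := hc (.inr k) x hx
      exact ⟨⟨k, t, ht⟩, rfl, hxt⟩
    · rintro ⟨k, t, ht⟩ x hx
      refine ⟨hs t hx, fun hxZ => ?_⟩
      obtain ⟨⟨p, hp⟩, hxp⟩ := Set.mem_iUnion.1 hxZ
      refine (Set.disjoint_left.1 (hd t p.2 ?_ hp.symm)) hx (hYs p hxp)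
      intro h
      have := p.2.2
      rw [← h, ht] at this
      cases this
    · rintro ⟨i, t, ht⟩ ⟨i', t', ht'⟩ hne htgt
      refine hd t t' ?_ htgt
      rintro rfl
      obtain rfl := Sum.inr_injective (ht.symm.trans ht')
      exact hne rfl

/-- In a zero-dimensional space, `a ≺ b` factors through a tuple of compact open sets. -/
lemma DynAux.exists_compactOpen
    (hzero : ∀ (p : X) (U : Set X), IsOpen U → p ∈ U →
      ∃ V : Set X, IsCompact V ∧ IsOpen V ∧ p ∈ V ∧ V ⊆ U)
    {a b : List (Opens X)} (h : DynAux Γ a b) :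
    ∃ B : Fin b.length → Opens X, (∀ k, IsCompact (B k : Set X)) ∧
      (∀ k, (B k : Set X) ⊆ b.get k) ∧
      ∀ F : Fin a.length → Set X, (∀ i, IsCompact (F i)) →
        (∀ i, F i ⊆ (a.get i : Set X)) → DynCover Γ F fun k => (B k : Set X) := by
  obtain ⟨c, hac, hlen, hcb⟩ := h
  have := fun i => exists_compactOpen_between hzero (hcb i).1 (b.get (Fin.cast hlen i)).isOpen
    (hcb i).2
  choose B hB hcB hBb using this
  refine ⟨fun k => B (Fin.cast hlen.symm k), fun k => hB _, fun k => hBb _, fun F hF hFa => ?_⟩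
  exact (dynSubeq_iff_dynCover.1 hac F hF hFa).mono (Equiv.refl _) (finCongr hlen)
    (fun _ => subset_rfl) fun k => subset_closure.trans (hcB k)

lemma dynWB_ofFn [T2Space X] {b : List (Opens X)} {B : Fin b.length → Opens X}
    (hB : ∀ k, IsCompact (B k : Set X)) (hBb : ∀ k, (B k : Set X) ⊆ b.get k) :
    DynWB (List.ofFn B) b := by
  refine ⟨by simp, fun i => ?_⟩
  rw [List.get_ofFn, (hB _).isClosed.closure_eq]
  exact ⟨hB _, hBb _⟩

lemma DynWB.append {a b c d : List (Opens X)} (h : DynWB a b) (h' : DynWB c d) :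
    DynWB (a ++ c) (b ++ d) := by
  obtain ⟨hl, h⟩ := h
  obtain ⟨hl', h'⟩ := h'
  refine ⟨by simp [hl, hl'], fun i => ?_⟩
  obtain ⟨j, rfl⟩ := (appendIndexEquiv a c).symm.surjective i
  have : Fin.cast (by simp [hl, hl']) ((appendIndexEquiv a c).symm j) =
      (appendIndexEquiv b d).symm (Sum.map (Fin.cast hl) (Fin.cast hl') j) := by
    rcases j with j | j <;> simp [appendIndexEquiv, Fin.ext_iff, hl]
  rw [this, get_append_symm, get_append_symm]
  rcases j with j | j
  exacts [h j, h' j]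

end DynW

/-- If `X` is moreover zero-dimensional (its topology has a basis of compact open sets),
then `W(X, Γ)` satisfies axiom (W5). -/
theorem dynW_satW5 {X : Type*} [TopologicalSpace X] [LocallyCompactSpace X] [T2Space X]
    [SecondCountableTopology X] {Γ : Type*} [Group Γ] [Countable Γ] [Infinite Γ]
    [MulAction Γ X] [ContinuousConstSMul Γ X]
    (hzero : ∀ (p : X) (U : Set X), IsOpen U → p ∈ U →
      ∃ V : Set X, IsCompact V ∧ IsOpen V ∧ p ∈ V ∧ V ⊆ U)
    (a' a b' b c ct : List (Opens X))
    (h1 : DynAux Γ (a ++ b) c) (h2 : DynAux Γ a' a) (h3 : DynAux Γ b' b)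
    (h4 : DynAux Γ c ct) :
    ∃ x x' : List (Opens X), DynAux Γ (a' ++ x) ct ∧ DynAux Γ c (a ++ x') ∧
      DynAux Γ b' x' ∧ DynAux Γ x' x := by
  obtain ⟨D, hD, hDc, habD⟩ := h1.exists_compactOpen hzero
  obtain ⟨A, hA, hAa, haA⟩ := h2.exists_compactOpen hzero
  obtain ⟨B, hB, hBb, hbB⟩ := h3.exists_compactOpen hzero
  obtain ⟨G, hG, hGc, hcG⟩ := h4.exists_compactOpen hzero
  let AB : Fin a.length ⊕ Fin b.length → Set X :=
    Sum.elim (fun i => (A i : Set X)) fun i => (B i : Set X)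
  have hAB : DynCover Γ AB fun k => (D k : Set X) := by
    refine (habD (AB ∘ appendIndexEquiv a b) ?_ ?_).mono (appendIndexEquiv a b).symm
      (Equiv.refl _) (fun i => by simp) fun _ => subset_rfl
    · intro i
      rcases h : appendIndexEquiv a b i with j | j
      · simpa [AB, h] using hA j
      · simpa [AB, h] using hB j
    · intro i
      obtain ⟨j, rfl⟩ := (appendIndexEquiv a b).symm.surjective i
      rw [get_append_symm]
      rcases j with j | j
      · simpa [AB] using hAa j
      · simpa [AB] using hBb j
  obtain ⟨R, hR, hARG, hGAR, hBR⟩ := DynCover.exists_complement hzero hA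
    (fun i => (A i).isOpen) hG (fun i => (G i).isOpen)
    (hAB.trans (hcG _ hD hDc))
  have hRR : DynCover Γ (fun k => (R k : Set X)) fun k => (R k : Set X) :=
    .refl fun k => (R k).isOpen
  have hRwb : DynWB (List.ofFn R) (List.ofFn R) := by
    refine ⟨rfl, fun i => ?_⟩
    rw [Fin.cast_eq_self, List.get_ofFn, (hR _).isClosed.closure_eq]
    exact ⟨hR _, subset_rfl⟩
  have hxR : ∀ F : Fin (List.ofFn R).length → Set X,
      (∀ i, F i ⊆ ((List.ofFn R).get i : Set X)) → DynCover Γ F fun k => (R k : Set X) :=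
    fun F hF => hRR.mono (finCongr (by simp)) (Equiv.refl _)
      (fun i => (hF i).trans (by rw [List.get_ofFn]; rfl)) fun _ => subset_rfl
  refine ⟨List.ofFn R, List.ofFn R, ⟨List.ofFn G, ?_, dynWB_ofFn hG hGc⟩,
    ⟨List.ofFn A ++ List.ofFn R, ?_, (dynWB_ofFn hA hAa).append hRwb⟩,
    ⟨List.ofFn R, ?_, hRwb⟩, ⟨List.ofFn R, ?_, hRwb⟩⟩
  · refine DynCover.dynSubeq_ofFn fun F hF hFa => ?_
    let e := appendIndexEquiv a' (List.ofFn R)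
    have hFe : ∀ j, F (e.symm j) ⊆ (Sum.elim a'.get (List.ofFn R).get j : Opens X) := by
      intro j
      rw [← get_append_symm]
      exact hFa _
    refine DynCover.trans ?_ hARG
    refine ((haA (fun i => F (e.symm (.inl i))) (fun _ => hF _) fun i => hFe (.inl i)).sum
      (hxR (fun i => F (e.symm (.inr i))) fun i => hFe (.inr i))).mono e (Equiv.refl _) ?_
      fun _ => subset_rfl
    intro i
    obtain ⟨j, rfl⟩ := e.symm.surjective i
    rw [Equiv.apply_symm_apply]
    rcases j with j | j <;> exact subset_rfl
  · refine dynSubeq_iff_dynCover.2 fun F hF hFc => ?_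
    refine ((hcG F hF hFc).trans hGAR).mono (Equiv.refl _)
      ((Equiv.sumCongr (finCongr (by simp)) (finCongr (by simp))).trans
        (appendIndexEquiv (List.ofFn A) (List.ofFn R)).symm) (fun _ => subset_rfl) ?_
    intro k
    rw [Equiv.trans_apply, get_append_symm]
    rcases k with k | k <;> simp [finCongr]
  · exact DynCover.dynSubeq_ofFn fun F hF hFb => (hbB F hF hFb).trans hBR
  · exact DynCover.dynSubeq_ofFn fun F _ hFx => hxR F hFx
end
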